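/- arXiv:0705.1766 — 3 statements merged into one kernel-verified Lean document; each statement's English description precedes it below -/
import Mathlib

section
/- (Robbins–Siegmund) Let F_0 ⊆ F_1 ⊆ … be a non-decreasing sequence of σ-algebras and let X_n, β_n, ξ_n, ζ_n be nonnegative F_n-measurable random variables, n ≥ 0, such that E[X_n | F_{n-1}] ≤ X_{n-1}(1 + β_{n-1}) + ξ_{n-1} − ζ_{n-1} for all sufficiently large n, almost surely. Then, almost surely, on the event { Σ_{i=1}^∞ ξ_{i-1} < ∞ } ∩ { Σ_{i=1}^∞ β_{i-1} < ∞ }, the limit lim_{n→∞} X_n exists and is finite, and Σ_{i=1}^∞ ζ_{i-1} < ∞. -/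
open Filter MeasureTheory

/-- A nonnegative almost supermartingale whose perturbations have uniformly bounded sums
converges almost surely, and the compensating terms are almost surely summable. -/
theorem ae_tendsto_and_summable_of_condExp_le_add_sub
    {Ω : Type*} {mΩ : MeasurableSpace Ω} {P : Measure Ω} [IsProbabilityMeasure P]
    {𝔉 : Filtration ℕ mΩ} {V x z : ℕ → Ω → ℝ} {a : ℝ}
    (hVm : ∀ n, StronglyMeasurable[𝔉 n] (V n))
    (hxm : ∀ n, StronglyMeasurable[𝔉 n] (x n))
    (hzm : ∀ n, StronglyMeasurable[𝔉 n] (z n))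
    (hV : ∀ n ω, 0 ≤ V n ω) (hx : ∀ n ω, 0 ≤ x n ω) (hz : ∀ n ω, 0 ≤ z n ω)
    (hVint : ∀ n, Integrable (V n) P)
    (hxa : ∀ n ω, ∑ i ∈ Finset.range n, x i ω ≤ a)
    (hle : ∀ n, ∀ᵐ ω ∂P, (P[V (n + 1)|𝔉 n]) ω ≤ V n ω + x n ω - z n ω) :
    ∀ᵐ ω ∂P, (∃ L : ℝ, Tendsto (fun n => V n ω) atTop (nhds L)) ∧
      Summable (fun i => z i ω) := by
  have hxint : ∀ n, Integrable (x n) P := fun n => by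
    refine Integrable.of_bound ((hxm n).mono (𝔉.le n)).aestronglyMeasurable a
      (ae_of_all _ fun ω => ?_)
    rw [Real.norm_of_nonneg (hx n ω)]
    exact (Finset.single_le_sum (f := fun i => x i ω) (fun i _ => hx i ω)
      (Finset.self_mem_range_succ n)).trans (hxa (n + 1) ω)
  have hzint : ∀ n, Integrable (z n) P := fun n => by
    refine ((hVint n).add (hxint n)).mono' ((hzm n).mono (𝔉.le n)).aestronglyMeasurable ?_
    filter_upwards [hle n, condExp_nonneg (m := 𝔉 n) (ae_of_all P (hV (n + 1)))] with ω h1 h2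
    rw [Real.norm_of_nonneg (hz n ω)]
    simp only [Pi.zero_apply, Pi.add_apply] at h2 ⊢
    linarith
  set c : ℝ := ∫ ω, V 0 ω ∂P with hc
  set D : ℕ → Ω → ℝ := fun n ω =>
    c + ∑ i ∈ Finset.range n, x i ω - ∑ i ∈ Finset.range n, z i ω with hD
  have hDm : ∀ n m, n ≤ m + 1 → StronglyMeasurable[𝔉 m] (D n) := fun n m hnm => by
    refine (stronglyMeasurable_const.add ?_).sub ?_
    · exact Finset.stronglyMeasurable_fun_sum _ fun i hi =>
        (hxm i).mono (𝔉.mono (by have := Finset.mem_range.1 hi; omega))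
    · exact Finset.stronglyMeasurable_fun_sum _ fun i hi =>
        (hzm i).mono (𝔉.mono (by have := Finset.mem_range.1 hi; omega))
  have hDint : ∀ n, Integrable (D n) P := fun n =>
    ((integrable_const c).add (integrable_finsetSum _ fun i _ => hxint i)).sub
      (integrable_finsetSum _ fun i _ => hzint i)
  have hsub : Submartingale (fun n => D n - V n) 𝔉 P := by
    refine submartingale_nat (fun n => (hDm n n n.le_succ).sub (hVm n))
      (fun n => (hDint n).sub (hVint n)) fun n => ?_
    filter_upwards [hle n, condExp_sub (hDint (n + 1)) (hVint (n + 1)) (𝔉 n)] with ω h1 h2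
    rw [h2, Pi.sub_apply, Pi.sub_apply,
      condExp_of_stronglyMeasurable (𝔉.le n) (hDm (n + 1) n le_rfl) (hDint (n + 1))]
    simp only [hD, Finset.sum_range_succ]
    linarith
  have hbdd : ∀ n, eLpNorm (D n - V n) 1 P ≤ ((2 * (c + a).toNNReal : NNReal) : ENNReal) := by
    intro n
    have hI : 0 ≤ ∫ ω, (D n - V n) ω ∂P := by
      have h := hsub.setIntegral_le (Nat.zero_le n) MeasurableSet.univ
      simp only [Measure.restrict_univ] at h
      refine le_trans (le_of_eq ?_) h
      simp only [hD, Pi.sub_apply, Finset.range_zero, Finset.sum_empty, add_zero, sub_zero]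
      rw [integral_sub (integrable_const c) (hVint 0)]
      simp [hc]
    refine (eLpNorm_one_le_of_le' (r := c + a) ((hDint n).sub (hVint n)) hI
      (ae_of_all _ fun ω => ?_)).trans (le_of_eq ?_)
    · have h1 := hxa n ω
      have h2 := hV n ω
      have h3 := Finset.sum_nonneg (s := Finset.range n) fun i _ => hz i ω
      simp only [hD, Pi.sub_apply]
      linarith
    · simp [ENNReal.ofReal]
  filter_upwards [hsub.exists_ae_tendsto_of_bdd hbdd] with ω ⟨l, hl⟩
  have hxs : Summable fun i => x i ω := summable_of_sum_range_le (fun i => hx i ω) fun n => hxa n ω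
  have hlim : Tendsto (fun n => V n ω + ∑ i ∈ Finset.range n, z i ω) atTop
      (nhds (c + ∑' i, x i ω - l)) :=
    ((hxs.hasSum.tendsto_sum_nat.const_add c).sub hl).congr fun n => by
      simp only [hD, Pi.sub_apply]
      ring
  have hzs : Summable fun i => z i ω := by
    obtain ⟨C, hC⟩ := hlim.bddAbove_range
    refine summable_of_sum_range_le (c := C) (fun i => hz i ω) fun n => ?_
    have := hC ⟨n, rfl⟩
    have := hV n ω
    simp only at *
    linarith
  exact ⟨⟨_, (hlim.sub hzs.hasSum.tendsto_sum_nat).congr fun n => by simp⟩, hzs⟩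

/-- Freezing a nonnegative series as soon as its partial sums exceed `a` keeps the sums
below `a`. -/
theorem sum_range_ite_sum_range_succ_le {u : ℕ → ℝ} (hu : ∀ n, 0 ≤ u n) {a : ℝ} (ha : 0 ≤ a)
    (n : ℕ) :
    ∑ i ∈ Finset.range n, (if ∑ j ∈ Finset.range (i + 1), u j ≤ a then u i else 0) ≤ a := by
  induction n with
  | zero => simpa
  | succ n ih =>
    by_cases h : ∑ j ∈ Finset.range (n + 1), u j ≤ a
    · refine (Finset.sum_le_sum fun i _ => ?_).trans h
      split_ifs
      exacts [le_rfl, hu i]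
    · rw [Finset.sum_range_succ, if_neg h, add_zero]
      exact ih

/-- The discount factor `1 / ∏ (1 + b i)`, killed once the partial sums of `u` exceed `a`. -/
noncomputable def killedDiscount (a : ℝ) (b u : ℕ → ℝ) (n : ℕ) : ℝ :=
  if ∑ i ∈ Finset.range n, u i ≤ a then (∏ i ∈ Finset.range n, (1 + b i))⁻¹ else 0

theorem one_le_prod_one_add {b : ℕ → ℝ} (hb : ∀ n, 0 ≤ b n) (n : ℕ) :
    1 ≤ ∏ i ∈ Finset.range n, (1 + b i) := by
  induction n with
  | zero => simp
  | succ n ih =>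
    rw [Finset.prod_range_succ]
    exact one_le_mul_of_one_le_of_one_le ih (by linarith [hb n])

theorem killedDiscount_nonneg {a : ℝ} {b u : ℕ → ℝ} (hb : ∀ n, 0 ≤ b n) (n : ℕ) :
    0 ≤ killedDiscount a b u n := by
  unfold killedDiscount
  split_ifs
  · exact inv_nonneg.2 (zero_le_one.trans (one_le_prod_one_add hb n))
  · exact le_rfl

theorem killedDiscount_le_one {a : ℝ} {b u : ℕ → ℝ} (hb : ∀ n, 0 ≤ b n) (n : ℕ) :
    killedDiscount a b u n ≤ 1 := by
  unfold killedDiscount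
  split_ifs
  · exact inv_le_one_of_one_le₀ (one_le_prod_one_add hb n)
  · exact zero_le_one

theorem killedDiscount_succ_mul_le {a : ℝ} {b u : ℕ → ℝ} (hb : ∀ n, 0 ≤ b n)
    (hu : ∀ n, 0 ≤ u n) (n : ℕ) :
    killedDiscount a b u (n + 1) * (1 + b n) ≤ killedDiscount a b u n := by
  by_cases h : ∑ i ∈ Finset.range (n + 1), u i ≤ a
  · have h' : ∑ i ∈ Finset.range n, u i ≤ a := by
      rw [Finset.sum_range_succ] at h
      linarith [hu n]
    have hbn : 1 + b n ≠ 0 := by linarith [hb n]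
    rw [killedDiscount, killedDiscount, if_pos h, if_pos h', Finset.prod_range_succ, mul_inv,
      inv_mul_cancel_right₀ hbn]
  · rw [killedDiscount, if_neg h, zero_mul]
    exact killedDiscount_nonneg hb n

theorem sum_range_killedDiscount_succ_mul_le {a : ℝ} {b u : ℕ → ℝ} (hb : ∀ n, 0 ≤ b n)
    (hu : ∀ n, 0 ≤ u n) (ha : 0 ≤ a) (n : ℕ) :
    ∑ i ∈ Finset.range n, killedDiscount a b u (i + 1) * u i ≤ a := by
  refine (Finset.sum_le_sum fun i _ => ?_).trans (sum_range_ite_sum_range_succ_le hu ha n)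
  split_ifs with h
  · exact mul_le_of_le_one_left (hu i) (killedDiscount_le_one hb _)
  · rw [killedDiscount, if_neg h, zero_mul]

theorem stronglyMeasurable_killedDiscount {Ω : Type*} {m : MeasurableSpace Ω}
    {β ξ : ℕ → Ω → ℝ} {n : ℕ} (a : ℝ) (hβ : ∀ i < n, StronglyMeasurable (β i))
    (hξ : ∀ i < n, StronglyMeasurable (ξ i)) :
    StronglyMeasurable fun ω => killedDiscount a (β · ω) (ξ · ω) n := by
  have h1 : Measurable fun ω => ∑ i ∈ Finset.range n, ξ i ω :=
    Finset.measurable_fun_sum _ fun i hi => (hξ i (Finset.mem_range.1 hi)).measurable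
  have h2 : Measurable fun ω => ∏ i ∈ Finset.range n, (1 + β i ω) :=
    Finset.measurable_fun_prod _ fun i hi =>
      measurable_const.add (hβ i (Finset.mem_range.1 hi)).measurable
  exact (Measurable.ite (measurableSet_le h1 measurable_const) h2.inv
    measurable_const).stronglyMeasurable

/-- The Robbins–Siegmund lemma when the drift inequality holds from the start. -/
theorem robbins_siegmund_of_forall
    {Ω : Type*} {mΩ : MeasurableSpace Ω} (P : Measure Ω) [IsProbabilityMeasure P]
    (𝔉 : Filtration ℕ mΩ)
    (X β ξ ζ : ℕ → Ω → ℝ)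
    (hXm : ∀ n, StronglyMeasurable[𝔉 n] (X n))
    (hβm : ∀ n, StronglyMeasurable[𝔉 n] (β n))
    (hξm : ∀ n, StronglyMeasurable[𝔉 n] (ξ n))
    (hζm : ∀ n, StronglyMeasurable[𝔉 n] (ζ n))
    (hXnonneg : ∀ n ω, 0 ≤ X n ω)
    (hβnonneg : ∀ n ω, 0 ≤ β n ω)
    (hξnonneg : ∀ n ω, 0 ≤ ξ n ω)
    (hζnonneg : ∀ n ω, 0 ≤ ζ n ω)
    (hXint : ∀ n, Integrable (X n) P)
    (hineq : ∀ n, ∀ᵐ ω ∂P,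
      (P[X (n + 1)|𝔉 n]) ω ≤ X n ω * (1 + β n ω) + ξ n ω - ζ n ω) :
    ∀ᵐ ω ∂P,
      (Summable (fun i => ξ i ω) ∧ Summable (fun i => β i ω)) →
        (∃ L : ℝ, Tendsto (fun n => X n ω) atTop (nhds L)) ∧
          Summable (fun i => ζ i ω) := by
  have key : ∀ k : ℕ, ∀ᵐ ω ∂P,
      (∃ L : ℝ, Tendsto (fun n => killedDiscount k (β · ω) (ξ · ω) n * X n ω) atTop (nhds L)) ∧
        Summable (fun i => killedDiscount k (β · ω) (ξ · ω) (i + 1) * ζ i ω) := fun k => by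
    set w : ℕ → Ω → ℝ := fun n ω => killedDiscount k (β · ω) (ξ · ω) n with hw
    have hw0 : ∀ n ω, 0 ≤ w n ω := fun n ω => killedDiscount_nonneg (hβnonneg · ω) n
    have hw1 : ∀ n ω, ‖w n ω‖ ≤ 1 := fun n ω => by
      rw [Real.norm_of_nonneg (hw0 n ω)]
      exact killedDiscount_le_one (hβnonneg · ω) n
    have hwm : ∀ n m, n ≤ m + 1 → StronglyMeasurable[𝔉 m] (w n) := fun n m hnm =>
      stronglyMeasurable_killedDiscount (k : ℝ)
        (fun i hi => (hβm i).mono (𝔉.mono (by omega)))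
        (fun i hi => (hξm i).mono (𝔉.mono (by omega)))
    have hwX : ∀ n, Integrable (w n * X n) P := fun n =>
      (hXint n).bdd_mul ((hwm n n n.le_succ).mono (𝔉.le n)).aestronglyMeasurable
        (ae_of_all _ (hw1 n))
    refine ae_tendsto_and_summable_of_condExp_le_add_sub (P := P) (𝔉 := 𝔉)
      (V := fun n => w n * X n) (x := fun n => w (n + 1) * ξ n) (z := fun n => w (n + 1) * ζ n)
      (a := k)
      (fun n => (hwm n n n.le_succ).mul (hXm n))
      (fun n => (hwm (n + 1) n le_rfl).mul (hξm n))
      (fun n => (hwm (n + 1) n le_rfl).mul (hζm n))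
      (fun n ω => mul_nonneg (hw0 n ω) (hXnonneg n ω))
      (fun n ω => mul_nonneg (hw0 _ ω) (hξnonneg n ω))
      (fun n ω => mul_nonneg (hw0 _ ω) (hζnonneg n ω)) hwX
      (fun n ω => sum_range_killedDiscount_succ_mul_le (hβnonneg · ω) (hξnonneg · ω)
        k.cast_nonneg n) fun n => ?_
    filter_upwards [hineq n, condExp_mul_of_stronglyMeasurable_left (hwm (n + 1) n le_rfl)
      (hwX (n + 1)) (hXint (n + 1))] with ω h1 h2
    rw [h2]
    simp only [Pi.mul_apply]
    have h3 := mul_le_mul_of_nonneg_left h1 (hw0 (n + 1) ω)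
    have h4 := mul_le_mul_of_nonneg_right
      (killedDiscount_succ_mul_le (a := k) (hβnonneg · ω) (hξnonneg · ω) n) (hXnonneg n ω)
    simp only [hw] at h3 ⊢
    linarith
  filter_upwards [ae_all_iff.2 key] with ω hω ⟨hξs, hβs⟩
  obtain ⟨k, hk⟩ := exists_nat_ge (∑' i, ξ i ω)
  obtain ⟨⟨L, hL⟩, hζs⟩ := hω k
  have hkd : ∀ n, killedDiscount k (β · ω) (ξ · ω) n =
      (∏ i ∈ Finset.range n, (1 + β i ω))⁻¹ := fun n =>
    if_pos ((hξs.sum_le_tsum _ fun i _ => hξnonneg i ω).trans hk)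
  have hprod1 : ∀ n, 1 ≤ ∏ i ∈ Finset.range n, (1 + β i ω) := one_le_prod_one_add (hβnonneg · ω)
  have hprod0 : ∀ n, ∏ i ∈ Finset.range n, (1 + β i ω) ≠ 0 := fun n =>
    (zero_lt_one.trans_le (hprod1 n)).ne'
  have hprod := (Real.multipliable_one_add_of_summable hβs).hasProd.tendsto_prod_nat
  simp only [hkd] at hL hζs
  refine ⟨⟨_, (hprod.mul hL).congr fun n => mul_inv_cancel_left₀ (hprod0 n) _⟩, ?_⟩
  obtain ⟨C, hC⟩ := hprod.bddAbove_range
  refine Summable.of_nonneg_of_le (fun i => hζnonneg i ω) (fun i => ?_) (hζs.mul_left C)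
  calc ζ i ω = (∏ j ∈ Finset.range (i + 1), (1 + β j ω)) *
        ((∏ j ∈ Finset.range (i + 1), (1 + β j ω))⁻¹ * ζ i ω) :=
      (mul_inv_cancel_left₀ (hprod0 _) _).symm
    _ ≤ _ := mul_le_mul_of_nonneg_right (hC ⟨i + 1, rfl⟩)
      (mul_nonneg (inv_nonneg.2 (zero_le_one.trans (hprod1 _))) (hζnonneg i ω))

/-- Robbins–Siegmund lemma (Lemma A1): let `F_0 ⊆ F_1 ⊆ ⋯` be a filtration and let
`X_n, β_n, ξ_n, ζ_n` be nonnegative `F_n`-measurable random variables with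
`E[X_n | F_{n-1}] ≤ X_{n-1}(1 + β_{n-1}) + ξ_{n-1} - ζ_{n-1}` for all sufficiently large
`n`.  Then, almost surely, on `{∑ ξ < ∞} ∩ {∑ β < ∞}`, `lim X_n` exists and is finite and
`∑ ζ < ∞`. -/
theorem robbins_siegmund
    {Ω : Type*} {mΩ : MeasurableSpace Ω} (P : Measure Ω) [IsProbabilityMeasure P]
    (𝔉 : Filtration ℕ mΩ)
    (X β ξ ζ : ℕ → Ω → ℝ)
    (hXm : ∀ n, StronglyMeasurable[𝔉 n] (X n))
    (hβm : ∀ n, StronglyMeasurable[𝔉 n] (β n))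
    (hξm : ∀ n, StronglyMeasurable[𝔉 n] (ξ n))
    (hζm : ∀ n, StronglyMeasurable[𝔉 n] (ζ n))
    (hXnonneg : ∀ n ω, 0 ≤ X n ω)
    (hβnonneg : ∀ n ω, 0 ≤ β n ω)
    (hξnonneg : ∀ n ω, 0 ≤ ξ n ω)
    (hζnonneg : ∀ n ω, 0 ≤ ζ n ω)
    (hXint : ∀ n, Integrable (X n) P)
    (hineq : ∃ N : ℕ, ∀ n ≥ N, ∀ᵐ ω ∂P,
      (P[X (n + 1)|𝔉 n]) ω ≤ X n ω * (1 + β n ω) + ξ n ω - ζ n ω) :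
    ∀ᵐ ω ∂P,
      (Summable (fun i => ξ i ω) ∧ Summable (fun i => β i ω)) →
        (∃ L : ℝ, Tendsto (fun n => X n ω) atTop (nhds L)) ∧
          Summable (fun i => ζ i ω) := by
  obtain ⟨N, hN⟩ := hineq
  let 𝔊 : Filtration ℕ mΩ :=
    ⟨fun n => 𝔉 (n + N), fun i j hij => 𝔉.mono (by omega), fun n => 𝔉.le (n + N)⟩
  filter_upwards [robbins_siegmund_of_forall P 𝔊 (fun n => X (n + N)) (fun n => β (n + N))
    (fun n => ξ (n + N)) (fun n => ζ (n + N)) (fun n => hXm (n + N)) (fun n => hβm (n + N))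
    (fun n => hξm (n + N)) (fun n => hζm (n + N)) (fun n => hXnonneg (n + N))
    (fun n => hβnonneg (n + N)) (fun n => hξnonneg (n + N)) (fun n => hζnonneg (n + N))
    (fun n => hXint (n + N)) fun n => by
      have h := hN (n + N) (Nat.le_add_left N n)
      rwa [Nat.add_right_comm] at h] with ω hω ⟨h1, h2⟩
  obtain ⟨⟨L, hL⟩, hs⟩ := hω ⟨(summable_nat_add_iff (f := fun i => ξ i ω) N).2 h1,
    (summable_nat_add_iff (f := fun i => β i ω) N).2 h2⟩
  exact ⟨⟨L, (tendsto_add_atTop_iff_nat (f := fun n => X n ω) N).1 hL⟩,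
    (summable_nat_add_iff (f := fun i => ζ i ω) N).1 hs⟩
end

section
/- Let g ≢ 0 be a nonnegative even continuous function on ℝ that is nonincreasing on ℝ₊ with g(z) → 0 as z → ∞, and let φ be a measurable odd function on ℝ with φ(z) > 0 for z > 0 and ∫_ℝ |φ(z − w)| g(z) dz < ∞ for all w ∈ ℝ. Then for every ε ∈ (0,1), sup_{ε ≤ |w| ≤ 1/ε} w ∫_{−∞}^{∞} φ(z − w) g(z) dz < 0. -/
open Filter MeasureTheory

lemma even_antitoneOn_le_of_abs_le {g : ℝ → ℝ} (hgeven : ∀ z, g (-z) = g z)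
    (hganti : AntitoneOn g (Set.Ici (0 : ℝ))) {a b : ℝ} (hab : |a| ≤ |b|) : g b ≤ g a := by
  have habs : ∀ x, g |x| = g x := fun x => by
    rcases abs_choice x with h | h <;> rw [h]
    exact hgeven x
  rw [← habs a, ← habs b]
  exact hganti (abs_nonneg a) (abs_nonneg b) hab

/-- The symmetrised integrand has a constant sign. -/
lemma mul_odd_mul_sub_nonneg {g φ : ℝ → ℝ} (hgeven : ∀ z, g (-z) = g z)
    (hganti : AntitoneOn g (Set.Ici (0 : ℝ))) (hφodd : ∀ z, φ (-z) = -φ z)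
    (hφpos : ∀ z, 0 < z → 0 < φ z) (w u : ℝ) :
    0 ≤ w * (φ u * (g (u - w) - g (u + w))) := by
  have hpos : ∀ w u : ℝ, 0 < u → 0 ≤ w * (φ u * (g (u - w) - g (u + w))) := by
    intro w u hu
    rcases le_total 0 w with hw | hw
    · have h : g (u + w) ≤ g (u - w) := even_antitoneOn_le_of_abs_le hgeven hganti
        (sq_le_sq.1 (by nlinarith [mul_nonneg hu.le hw]))
      exact mul_nonneg hw (mul_nonneg (hφpos u hu).le (sub_nonneg.2 h))
    · have h : g (u - w) ≤ g (u + w) := even_antitoneOn_le_of_abs_le hgeven hganti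
        (sq_le_sq.1 (by nlinarith [mul_nonneg hu.le (neg_nonneg.2 hw)]))
      exact mul_nonneg_of_nonpos_of_nonpos hw
        (mul_nonpos_of_nonneg_of_nonpos (hφpos u hu).le (sub_nonpos.2 h))
  rcases lt_trichotomy u 0 with hu | rfl | hu
  · have h := hpos w (-u) (neg_pos.2 hu)
    rw [hφodd, show -u - w = -(u + w) by ring, show -u + w = -(u - w) by ring, hgeven,
      hgeven] at h
    linarith
  · have h : φ 0 = 0 := by have := hφodd 0; rw [neg_zero] at this; linarith
    simp [h]
  · exact hpos w u hu

lemma integrable_mul_comp_add {g φ : ℝ → ℝ} (hgmeas : Measurable g) (hgnonneg : ∀ z, 0 ≤ g z)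
    (hφmeas : Measurable φ) (hint : ∀ w : ℝ, Integrable (fun z => |φ (z - w)| * g z)) (w : ℝ) :
    Integrable (fun u => φ u * g (u + w)) := by
  refine ((hint w).comp_add_right w).mono' (by fun_prop) (Eventually.of_forall fun u => ?_)
  simp [abs_of_nonneg (hgnonneg _)]

lemma two_mul_integral_comp_sub_mul {g φ : ℝ → ℝ} (hgeven : ∀ z, g (-z) = g z)
    (hφodd : ∀ z, φ (-z) = -φ z) (hint : ∀ w, Integrable (fun u => φ u * g (u + w))) (w : ℝ) :
    2 * ∫ z, φ (z - w) * g z = -∫ u, φ u * (g (u - w) - g (u + w)) := by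
  have hshift : ∫ z, φ (z - w) * g z = ∫ u, φ u * g (u + w) := by
    rw [← integral_add_right_eq_self (fun z => φ (z - w) * g z) w]
    simp
  have hrefl : ∫ u, φ u * g (u + w) = -∫ u, φ u * g (u + -w) := by
    rw [← integral_neg_eq_self (fun u => φ u * g (u + w)), ← integral_neg]
    congr 1
    ext u
    rw [hφodd, show -u + w = -(u + -w) by ring, hgeven, neg_mul]
  simp only [mul_sub, sub_eq_add_neg _ w] at hrefl ⊢
  rw [integral_sub (hint (-w)) (hint w)]
  simp only [← sub_eq_add_neg _ w] at hrefl ⊢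
  linarith

/-- An integrable weight dominated by `|φ|`. -/
noncomputable def truncatedWeight (φ : ℝ → ℝ) (u : ℝ) : ℝ := min |φ u| (1 + u ^ 2)⁻¹

lemma truncatedWeight_nonneg (φ : ℝ → ℝ) (u : ℝ) : 0 ≤ truncatedWeight φ u :=
  le_min (abs_nonneg _) (by positivity)

lemma measurable_truncatedWeight {φ : ℝ → ℝ} (hφ : Measurable φ) :
    Measurable (truncatedWeight φ) := by
  unfold truncatedWeight
  fun_prop

lemma integrable_truncatedWeight {φ : ℝ → ℝ} (hφ : Measurable φ) :
    Integrable (truncatedWeight φ) := by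
  refine integrable_inv_one_add_sq.mono' (measurable_truncatedWeight hφ).aestronglyMeasurable
    (Eventually.of_forall fun u => ?_)
  rw [Real.norm_of_nonneg (truncatedWeight_nonneg φ u)]
  exact min_le_right _ _

lemma norm_truncatedWeight_mul_le {φ g : ℝ → ℝ} {C : ℝ} (hgnonneg : ∀ z, 0 ≤ g z)
    (hgle : ∀ z, g z ≤ C) (w u : ℝ) :
    ‖truncatedWeight φ u * |g (u - w) - g (u + w)|‖ ≤ truncatedWeight φ u * C := by
  rw [Real.norm_of_nonneg (mul_nonneg (truncatedWeight_nonneg φ u) (abs_nonneg _))]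
  refine mul_le_mul_of_nonneg_left ?_ (truncatedWeight_nonneg φ u)
  rw [abs_le]
  constructor <;> linarith [hgnonneg (u - w), hgnonneg (u + w), hgle (u - w), hgle (u + w)]

lemma aestronglyMeasurable_truncatedWeight_mul {φ g : ℝ → ℝ} (hφ : Measurable φ)
    (hgcont : Continuous g) (w : ℝ) :
    AEStronglyMeasurable (fun u => truncatedWeight φ u * |g (u - w) - g (u + w)|) := by
  have := measurable_truncatedWeight hφ
  exact this.aestronglyMeasurable.mul (Continuous.aestronglyMeasurable (by fun_prop))

lemma integrable_truncatedWeight_mul {φ g : ℝ → ℝ} {C : ℝ} (hφ : Measurable φ)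
    (hgcont : Continuous g) (hgnonneg : ∀ z, 0 ≤ g z) (hgle : ∀ z, g z ≤ C) (w : ℝ) :
    Integrable (fun u => truncatedWeight φ u * |g (u - w) - g (u + w)|) :=
  ((integrable_truncatedWeight hφ).mul_const C).mono'
    (aestronglyMeasurable_truncatedWeight_mul hφ hgcont w)
    (Eventually.of_forall (norm_truncatedWeight_mul_le hgnonneg hgle w))

lemma continuous_integral_truncatedWeight_mul {φ g : ℝ → ℝ} {C : ℝ} (hφ : Measurable φ)
    (hgcont : Continuous g) (hgnonneg : ∀ z, 0 ≤ g z) (hgle : ∀ z, g z ≤ C) :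
    Continuous (fun w => ∫ u, truncatedWeight φ u * |g (u - w) - g (u + w)|) :=
  continuous_of_dominated (aestronglyMeasurable_truncatedWeight_mul hφ hgcont)
    (fun w => Eventually.of_forall (norm_truncatedWeight_mul_le hgnonneg hgle w))
    ((integrable_truncatedWeight hφ).mul_const C)
    (Eventually.of_forall fun u => by fun_prop)

lemma Function.Periodic.eq_of_tendsto_atTop {g : ℝ → ℝ} {c l : ℝ} (hg : Function.Periodic g c)
    (hc : c ≠ 0) (hlim : Tendsto g atTop (nhds l)) (x : ℝ) : g x = l := by
  have key : ∀ c : ℝ, 0 < c → Function.Periodic g c → g x = l := by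
    intro c hc hg
    have h1 : Tendsto (fun n : ℕ => x + n * c) atTop atTop :=
      tendsto_atTop_add_const_left _ _ (tendsto_natCast_atTop_atTop.atTop_mul_const hc)
    have h2 := hlim.comp h1
    have h3 : g ∘ (fun n : ℕ => x + n * c) = fun _ => g x := funext fun n => hg.nat_mul n x
    rw [h3] at h2
    exact tendsto_nhds_unique tendsto_const_nhds h2
  rcases hc.lt_or_gt with h | h
  · exact key (-c) (neg_pos.2 h) hg.neg
  · exact key c h hg

lemma integral_truncatedWeight_mul_pos {φ g : ℝ → ℝ} {C : ℝ} (hφ : Measurable φ)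
    (hφne : ∀ z, z ≠ 0 → φ z ≠ 0) (hgcont : Continuous g) (hgnonneg : ∀ z, 0 ≤ g z)
    (hgle : ∀ z, g z ≤ C) (hgne : g ≠ 0) (hglim : Tendsto g atTop (nhds 0)) {w : ℝ}
    (hw : w ≠ 0) : 0 < ∫ u, truncatedWeight φ u * |g (u - w) - g (u + w)| := by
  have hnn : 0 ≤ fun u => truncatedWeight φ u * |g (u - w) - g (u + w)| :=
    fun u => mul_nonneg (truncatedWeight_nonneg φ u) (abs_nonneg _)
  refine lt_of_le_of_ne (integral_nonneg hnn) fun h0 => hgne ?_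
  have hae := (integral_eq_zero_iff_of_nonneg hnn
    (integrable_truncatedWeight_mul hφ hgcont hgnonneg hgle w)).1 h0.symm
  have heq : (fun u => g (u - w)) =ᵐ[volume] fun u => g (u + w) := by
    filter_upwards [hae, Measure.ae_ne volume (0 : ℝ)] with u hu hu0
    have hψ : 0 < truncatedWeight φ u := lt_min (abs_pos.2 (hφne u hu0)) (by positivity)
    have := (mul_eq_zero.1 hu).resolve_left hψ.ne'
    exact sub_eq_zero.1 (abs_eq_zero.1 this)
  have heq' := (Continuous.ae_eq_iff_eq volume (by fun_prop) (by fun_prop)).1 heq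
  have hper : Function.Periodic g (2 * w) := fun x => by
    have := congrFun heq' (x + w)
    simp only [add_sub_cancel_right] at this
    rw [this]
    congr 1
    ring
  exact funext fun x => hper.eq_of_tendsto_atTop (by simpa using hw) hglim x

/-- Lemma A2, inequality (A2): under the hypotheses of (A1) and continuity of `g`,
for every `ε ∈ (0,1)`, `sup_{ε ≤ |w| ≤ 1/ε} w ∫ φ(z - w) g(z) dz < 0`. -/
theorem odd_bellshaped_integral_sup_neg (g φ : ℝ → ℝ)
    (hgmeas : Measurable g)
    (hgne : g ≠ 0)
    (hgnonneg : ∀ z, 0 ≤ g z)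
    (hgeven : ∀ z, g (-z) = g z)
    (hganti : AntitoneOn g (Set.Ici (0 : ℝ)))
    (hglim : Tendsto g atTop (nhds 0))
    (hgcont : Continuous g)
    (hφmeas : Measurable φ)
    (hφodd : ∀ z, φ (-z) = -φ z)
    (hφpos : ∀ z, 0 < z → 0 < φ z)
    (hint : ∀ w : ℝ, Integrable (fun z => |φ (z - w)| * g z)) :
    ∀ ε ∈ Set.Ioo (0 : ℝ) 1,
      sSup ((fun w => w * ∫ z, φ (z - w) * g z) ''
        {w : ℝ | ε ≤ |w| ∧ |w| ≤ 1 / ε}) < 0 := by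
  rintro ε ⟨hε0, hε1⟩
  have hgle : ∀ z, g z ≤ g 0 := fun z =>
    even_antitoneOn_le_of_abs_le hgeven hganti (by simp)
  have hφne : ∀ z, z ≠ 0 → φ z ≠ 0 := by
    intro z hz
    rcases hz.lt_or_gt with h | h
    · have := hφpos (-z) (neg_pos.2 h)
      rw [hφodd] at this
      linarith
    · exact (hφpos z h).ne'
  have hint' := integrable_mul_comp_add hgmeas hgnonneg hφmeas hint
  set S : Set ℝ := {w : ℝ | ε ≤ |w| ∧ |w| ≤ 1 / ε} with hS
  have hSne : S.Nonempty := ⟨1, by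
    simp only [hS, Set.mem_ofPred_eq, abs_one]
    exact ⟨hε1.le, by rw [le_div_iff₀ hε0]; linarith⟩⟩
  have hScomp : IsCompact S := by
    refine (isCompact_Icc (a := -(1 / ε)) (b := 1 / ε)).of_isClosed_subset ?_
      fun w hw => abs_le.1 hw.2
    exact (isClosed_le continuous_const continuous_abs).inter
      (isClosed_le continuous_abs continuous_const)
  set G : ℝ → ℝ := fun w => |w| * ∫ u, truncatedWeight φ u * |g (u - w) - g (u + w)| with hG
  have hGcont : Continuous G :=
    continuous_abs.mul (continuous_integral_truncatedWeight_mul hφmeas hgcont hgnonneg hgle)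
  obtain ⟨w₀, hw₀, hmin⟩ := hScomp.exists_isMinOn hSne hGcont.continuousOn
  have hw₀ne : w₀ ≠ 0 := abs_pos.1 (hε0.trans_le hw₀.1)
  have hGpos : 0 < G w₀ := mul_pos (abs_pos.2 hw₀ne)
    (integral_truncatedWeight_mul_pos hφmeas hφne hgcont hgnonneg hgle hgne hglim hw₀ne)
  have hbound : ∀ w, G w ≤ -2 * (w * ∫ z, φ (z - w) * g z) := by
    intro w
    have hId : -2 * (w * ∫ z, φ (z - w) * g z) = ∫ u, w * (φ u * (g (u - w) - g (u + w))) := by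
      rw [integral_const_mul]
      linear_combination -w * two_mul_integral_comp_sub_mul hgeven hφodd hint' w
    rw [hId, hG]
    simp only [← integral_const_mul]
    refine integral_mono
      ((integrable_truncatedWeight_mul hφmeas hgcont hgnonneg hgle w).const_mul _) ?_ fun u => ?_
    · have := ((hint' (-w)).sub (hint' w)).const_mul w
      refine this.congr (Eventually.of_forall fun u => ?_)
      simp only [Pi.sub_apply, ← sub_eq_add_neg]
      ring
    · have hsign := mul_odd_mul_sub_nonneg hgeven hganti hφodd hφpos w u
      simp only
      rw [← abs_of_nonneg hsign, abs_mul, abs_mul]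
      gcongr
      exact min_le_left _ _
  refine lt_of_le_of_lt (csSup_le (a := -(G w₀ / 2)) (hSne.image _) ?_) (by linarith)
  rintro _ ⟨w, hw, rfl⟩
  have h1 := hbound w
  have h2 : G w₀ ≤ G w := hmin hw
  simp only
  linarith
end

section
/- Let g ≢ 0 be a nonnegative even continuous function on ℝ that is nonincreasing on ℝ₊ with g(z) → 0 as z → ∞, and let φ be a measurable odd function on ℝ with φ(z) > 0 for z > 0 and ∫_ℝ |φ(z − w)| g(z) dz < ∞ for all w ∈ ℝ. Then the function Φ(w) = ∫_{−∞}^{∞} φ(z − w) g(z) dz is continuous on the set { w : ε ≤ |w| ≤ 1/ε } for every ε ∈ (0,1) (the defining integral converges uniformly there). -/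
open Filter MeasureTheory

theorem le_of_abs_le_abs_of_even_of_antitoneOn {g : ℝ → ℝ} (hgeven : ∀ z, g (-z) = g z)
    (hganti : AntitoneOn g (Set.Ici (0 : ℝ))) {a b : ℝ} (h : |a| ≤ |b|) : g b ≤ g a := by
  have habs : ∀ z, g |z| = g z := fun z => by
    rcases abs_choice z with hz | hz <;> simp [hz, hgeven]
  rw [← habs a, ← habs b]
  exact hganti (abs_nonneg a) (abs_nonneg b) h

theorem integrable_abs_mul_comp_add {g φ : ℝ → ℝ} {w : ℝ}
    (hint : Integrable (fun z => |φ (z - w)| * g z)) :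
    Integrable (fun y => |φ y| * g (y + w)) := by
  simpa using hint.comp_add_right w

theorem locallyIntegrable_of_integrable_abs_mul_comp_add {g φ : ℝ → ℝ}
    (hgcont : Continuous g) (hg0 : 0 < g 0) (hφmeas : Measurable φ)
    (hint : ∀ w : ℝ, Integrable (fun y => |φ y| * g (y + w))) :
    LocallyIntegrable φ := by
  intro x
  have hev : ∀ᶠ y in nhds x, g 0 / 2 < g (y + -x) := by
    have hc : ContinuousAt (fun y => g (y + -x)) x := by fun_prop
    exact hc.eventually_const_lt (by simpa using half_lt_self hg0)
  obtain ⟨s, hs, hso, hxs⟩ := eventually_nhds_iff.mp hev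
  refine ⟨s, hso.mem_nhds hxs, ?_⟩
  refine Integrable.mono' ((hint (-x)).integrableOn.const_mul (2 / g 0))
    hφmeas.aestronglyMeasurable ?_
  refine (ae_restrict_iff' hso.measurableSet).mpr (Eventually.of_forall fun y hy => ?_)
  have h2 : 1 ≤ 2 / g 0 * g (y + -x) := by
    have := hs y hy
    rw [div_mul_eq_mul_div, le_div_iff₀ hg0]
    linarith
  calc ‖φ y‖ = |φ y| * 1 := by simp
    _ ≤ |φ y| * (2 / g 0 * g (y + -x)) := by gcongr
    _ = 2 / g 0 * (|φ y| * g (y + -x)) := by ring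

theorem continuous_integral_comp_sub_mul {g φ : ℝ → ℝ}
    (hgne : g ≠ 0)
    (hgnonneg : ∀ z, 0 ≤ g z)
    (hgeven : ∀ z, g (-z) = g z)
    (hganti : AntitoneOn g (Set.Ici (0 : ℝ)))
    (hgcont : Continuous g)
    (hφmeas : Measurable φ)
    (hint : ∀ w : ℝ, Integrable (fun z => |φ (z - w)| * g z)) :
    Continuous (fun w => ∫ z, φ (z - w) * g z) := by
  have hmono : ∀ {a b : ℝ}, |a| ≤ |b| → g b ≤ g a :=
    le_of_abs_le_abs_of_even_of_antitoneOn hgeven hganti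
  have hle : ∀ z, g z ≤ g 0 := fun z => hmono (by simp)
  have hg0 : 0 < g 0 := by
    obtain ⟨z, hz⟩ := Function.ne_iff.mp hgne
    exact ((hgnonneg z).lt_of_ne' hz).trans_le (hle z)
  have hint' : ∀ w, Integrable (fun y => |φ y| * g (y + w)) :=
    fun w => integrable_abs_mul_comp_add (hint w)
  have hloc : LocallyIntegrable φ :=
    locallyIntegrable_of_integrable_abs_mul_comp_add hgcont hg0 hφmeas hint'
  have heq : (fun w => ∫ z, φ (z - w) * g z) = fun w => ∫ y, φ y * g (y + w) := by
    funext w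
    simpa using (integral_add_right_eq_self (fun z => φ (z - w) * g z) w).symm
  rw [heq, continuous_iff_continuousAt]
  intro w₀
  set M := |w₀| + 1 with hM
  have hnear : ∀ᶠ w in nhds w₀, |w| ≤ M :=
    (continuous_abs.continuousAt.eventually_lt_const (by simp [hM])).mono fun _ h => le_of_lt h
  refine continuousAt_of_dominated
    (bound := fun y => |φ y| * g (y + M) + |φ y| * g (y + -M) +
      (Set.Icc (-M) M).indicator (fun y => |φ y| * g 0) y) ?_ ?_ ?_ ?_
  · exact Eventually.of_forall fun w =>
      (hφmeas.mul (by fun_prop : Continuous fun y => g (y + w)).measurable).aestronglyMeasurable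
  · filter_upwards [hnear] with w hw
    refine Eventually.of_forall fun y => ?_
    obtain ⟨hw1, hw2⟩ := abs_le.mp hw
    have h1 := mul_nonneg (abs_nonneg (φ y)) (hgnonneg (y + M))
    have h2 := mul_nonneg (abs_nonneg (φ y)) (hgnonneg (y + -M))
    rw [norm_mul, Real.norm_eq_abs, Real.norm_of_nonneg (hgnonneg _)]
    by_cases hy : y ∈ Set.Icc (-M) M
    · rw [Set.indicator_of_mem hy]
      have := mul_le_mul_of_nonneg_left (hle (y + w)) (abs_nonneg (φ y))
      linarith
    · rw [Set.indicator_of_notMem hy]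
      rcases le_or_gt (-M) y with hy1 | hy1
      · have hy2 : M < y := by
          by_contra! hy2
          exact hy ⟨hy1, hy2⟩
        have := mul_le_mul_of_nonneg_left
          (hmono (a := y + -M) (b := y + w) (by
            rw [abs_of_nonneg (by linarith), abs_of_nonneg (by linarith)]; linarith))
          (abs_nonneg (φ y))
        linarith
      · have := mul_le_mul_of_nonneg_left
          (hmono (a := y + M) (b := y + w) (by
            rw [abs_of_nonpos (by linarith), abs_of_nonpos (by linarith)]; linarith))
          (abs_nonneg (φ y))
        linarith
  · refine ((hint' M).add (hint' (-M))).add ?_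
    rw [integrable_indicator_iff measurableSet_Icc]
    exact (hloc.integrableOn_isCompact isCompact_Icc).abs.mul_const (g 0)
  · exact Eventually.of_forall fun y => by fun_prop

/-- Lemma A2 (continuity step): under the hypotheses of (A1) and continuity of `g`,
the function `Φ(w) = ∫ φ(z - w) g(z) dz` is continuous on `{w : ε ≤ |w| ≤ 1/ε}`
for every `ε ∈ (0,1)`. -/
theorem odd_bellshaped_integral_continuousOn (g φ : ℝ → ℝ)
    (hgmeas : Measurable g)
    (hgne : g ≠ 0)
    (hgnonneg : ∀ z, 0 ≤ g z)
    (hgeven : ∀ z, g (-z) = g z)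
    (hganti : AntitoneOn g (Set.Ici (0 : ℝ)))
    (hglim : Tendsto g atTop (nhds 0))
    (hgcont : Continuous g)
    (hφmeas : Measurable φ)
    (hφodd : ∀ z, φ (-z) = -φ z)
    (hφpos : ∀ z, 0 < z → 0 < φ z)
    (hint : ∀ w : ℝ, Integrable (fun z => |φ (z - w)| * g z)) :
    ∀ ε ∈ Set.Ioo (0 : ℝ) 1,
      ContinuousOn (fun w => ∫ z, φ (z - w) * g z)
        {w : ℝ | ε ≤ |w| ∧ |w| ≤ 1 / ε} := by
  exact fun _ _ => (continuous_integral_comp_sub_mul hgne hgnonneg hgeven hganti hgcont hφmeas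
    hint).continuousOn
end
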